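/- Let m ≥ 1 be an integer, Y any type, π a partition of m, and s ∈ Sym^m Y. Then s ∈ W°_π(Y) if and only if the multiplicity partition μ(s) of s equals π. -/

import Mathlib

open Multiset

/-- `W π Y` is the set of multisets `a_1•{y_1} + ⋯ + a_k•{y_k}` in `Sym Y m`,
where `(a_1,…,a_k)` are the parts of the partition `π` of `m`. -/
def W {m : ℕ} (π : Nat.Partition m) (Y : Type*) : Set (Sym Y m) :=
  {s | ∃ t : Multiset (ℕ × Y), t.map Prod.fst = π.parts ∧
        (t.map fun p => Multiset.replicate p.1 p.2).sum = s.1}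


/-- `Coarsens π π′` means `π ≥ π′`, i.e. `π′` refines `π`: the parts of `π′` can be
grouped (by a surjection on the index sets of parts) so that each group sums to the
corresponding part of `π`.  Encoded via a multiset `t` of groups of parts. -/
def Coarsens {m : ℕ} (π π' : Nat.Partition m) : Prop :=
  ∃ t : Multiset (Multiset ℕ), t.map Multiset.sum = π.parts ∧ t.sum = π'.parts


/-- `Wo π Y = W π Y \ ⋃_{π′ > π} W π′ Y`, the open stratum. -/
def Wo {m : ℕ} (π : Nat.Partition m) (Y : Type*) : Set (Sym Y m) :=
  W π Y \ ⋃ (π' : Nat.Partition m) (_ : Coarsens π' π ∧ π' ≠ π), W π' Y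


/-- The multiplicity partition `μ(s)` of `s ∈ Sym Y m`: its parts are the multiplicities
in `s` of the distinct elements of `s`. -/
def mu {Y : Type*} [DecidableEq Y] {m : ℕ} (s : Sym Y m) : Nat.Partition m where
  parts := s.1.toFinset.val.map s.1.count
  parts_pos := by
    intro i hi
    rw [Multiset.mem_map] at hi
    obtain ⟨y, hy, rfl⟩ := hi
    exact Multiset.count_pos.mpr (by simpa using hy)
  parts_sum := by
    simpa [Finset.sum] using s.1.toFinset_sum_count_eq.trans s.2


theorem card_le_card_sum_of_sum_pos (t : Multiset (Multiset ℕ)) (h : ∀ a ∈ t, 0 < a.sum) :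
    card t ≤ card t.sum := by
  induction t using Multiset.induction_on with
  | empty => simp
  | cons a t ih =>
    have ht := ih fun b hb => h b (mem_cons_of_mem hb)
    have ha : 0 < card a := by
      rw [card_pos]
      rintro rfl
      simpa using h 0 (mem_cons_self _ _)
    simp only [card_cons, sum_cons, card_add]
    omega

theorem map_sum_eq_sum_of_card_sum_le (t : Multiset (Multiset ℕ)) (h : ∀ a ∈ t, 0 < a.sum)
    (hc : card t.sum ≤ card t) : t.map Multiset.sum = t.sum := by
  induction t using Multiset.induction_on with
  | empty => simp
  | cons a t ih =>
    have h' : ∀ b ∈ t, 0 < b.sum := fun b hb => h b (mem_cons_of_mem hb)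
    have ht := card_le_card_sum_of_sum_pos t h'
    have ha : 0 < card a := by
      rw [card_pos]
      rintro rfl
      simpa using h 0 (mem_cons_self _ _)
    simp only [card_cons, sum_cons, card_add] at hc
    obtain ⟨x, rfl⟩ := card_eq_one.mp (show card a = 1 by omega)
    rw [map_cons, sum_cons, ih h' (by omega), sum_singleton, singleton_add]

namespace Coarsens

theorem sum_pos_of_map_sum_eq {m : ℕ} {π : Nat.Partition m} {t : Multiset (Multiset ℕ)}
    (h : t.map Multiset.sum = π.parts) : ∀ a ∈ t, 0 < a.sum := fun _ ha =>
  π.parts_pos (h ▸ mem_map_of_mem _ ha)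

theorem card_parts_le {m : ℕ} {π π' : Nat.Partition m} (h : Coarsens π π') :
    card π.parts ≤ card π'.parts := by
  obtain ⟨t, h₁, h₂⟩ := h
  have := card_le_card_sum_of_sum_pos t (sum_pos_of_map_sum_eq h₁)
  rwa [← h₁, ← h₂, card_map]

theorem antisymm {m : ℕ} {π π' : Nat.Partition m} (h : Coarsens π π') (h' : Coarsens π' π) :
    π = π' := by
  have hc := h'.card_parts_le
  obtain ⟨t, h₁, h₂⟩ := h
  rw [← h₁, ← h₂, card_map] at hc
  ext1
  rw [← h₁, ← h₂]
  exact map_sum_eq_sum_of_card_sum_le t (sum_pos_of_map_sum_eq h₁) hc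

end Coarsens

theorem mem_W_mu {Y : Type*} [DecidableEq Y] {m : ℕ} (s : Sym Y m) : s ∈ W (mu s) Y := by
  refine ⟨s.1.toFinset.val.map fun y => (s.1.count y, y), ?_, ?_⟩
  · simp [mu]
  · rw [map_map]
    simpa [Finset.sum, nsmul_singleton, Function.comp_def] using s.1.toFinset_sum_count_nsmul_eq

theorem count_sum_map_replicate {Y : Type*} [DecidableEq Y] (t : Multiset (ℕ × Y)) (y : Y) :
    count y (t.map fun p => replicate p.1 p.2).sum =
      ((t.filter fun p => p.2 = y).map Prod.fst).sum := by
  induction t using Multiset.induction_on with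
  | empty => simp
  | cons p t ih =>
    rw [map_cons, sum_cons, count_add, ih, count_replicate]
    by_cases hp : p.2 = y <;> simp [hp]

theorem sum_filter_snd_eq {α Y : Type*} [DecidableEq Y] (t : Multiset (α × Y)) (S : Finset Y)
    (h : ∀ p ∈ t, p.2 ∈ S) : ∑ y ∈ S, t.filter (fun p => p.2 = y) = t := by
  induction t using Multiset.induction_on with
  | empty => simp
  | cons p t ih =>
    have hp := h p (mem_cons_self _ _)
    simp only [filter_cons, Finset.sum_add_distrib, ih fun q hq => h q (mem_cons_of_mem hq)]
    simp [hp]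

theorem coarsens_mu_of_mem_W {Y : Type*} [DecidableEq Y] {m : ℕ} {π : Nat.Partition m}
    {s : Sym Y m} (h : s ∈ W π Y) : Coarsens (mu s) π := by
  obtain ⟨t, h₁, h₂⟩ := h
  have hmem : ∀ p ∈ t, p.2 ∈ s.1.toFinset := fun p hp => by
    have hpos : 0 < p.1 := π.parts_pos (h₁ ▸ mem_map_of_mem _ hp)
    rw [mem_toFinset, ← h₂]
    exact mem_join.mpr ⟨_, mem_map_of_mem _ hp, mem_replicate.mpr ⟨hpos.ne', rfl⟩⟩
  refine ⟨s.1.toFinset.val.map fun y => (t.filter fun p => p.2 = y).map Prod.fst, ?_, ?_⟩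
  · rw [map_map]
    refine map_congr rfl fun y _ => ?_
    rw [Function.comp_apply, ← count_sum_map_replicate, h₂]
  · have := congrArg (Multiset.mapAddMonoidHom Prod.fst) (sum_filter_snd_eq t _ hmem)
    rw [map_sum] at this
    exact this.trans h₁

/-- `s ∈ W°_π(Y)` if and only if the multiplicity partition `μ(s)` of `s` equals `π`. -/
theorem mem_Wo_iff_mu_eq (m : ℕ) (hm : 1 ≤ m) (Y : Type*) [DecidableEq Y]
    (π : Nat.Partition m) (s : Sym Y m) :
    s ∈ Wo π Y ↔ mu s = π := by
  constructor
  · rintro ⟨hs, hn⟩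
    by_contra hne
    exact hn (Set.mem_iUnion₂.mpr ⟨mu s, ⟨coarsens_mu_of_mem_W hs, hne⟩, mem_W_mu s⟩)
  · rintro rfl
    refine ⟨mem_W_mu s, fun hs => ?_⟩
    obtain ⟨π', ⟨hc, hne⟩, hs'⟩ := Set.mem_iUnion₂.mp hs
    exact hne (hc.antisymm (coarsens_mu_of_mem_W hs'))
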